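/- Let k be a positive integer, let J_k be the 2k×2k real block-diagonal matrix with k diagonal blocks equal to [[0,-1],[1,0]], and let A be a real symmetric 2k×2k matrix satisfying A*J_k = -(J_k*A). Regard A as a complex matrix A_ℂ by applying the inclusion ℝ → ℂ entrywise. Then det(1 + i·A_ℂ) is a real number and is strictly positive: its imaginary part is 0 and its real part is > 0. In particular (det(1 + i·A_ℂ))² > 0. (This is the key determinant computation in the paper's proof that every holomorphic Lagrangian brane in T*ℂⁿ has an integer grading: since A anticommutes with J_k, the eigenvalues of the real symmetric matrix A pair as λ, -λ, so the factors (1+iλ)(1-iλ) = 1+λ² are positive.) -/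

import Mathlib

/-- The `2k × 2k` real block-diagonal matrix with `k` diagonal blocks `[[0,-1],[1,0]]`
(indexed by `Fin 2 × Fin k`). -/
noncomputable def Jblock (k : ℕ) : Matrix (Fin 2 × Fin k) (Fin 2 × Fin k) ℝ :=
  Matrix.blockDiagonal (fun _ : Fin k => !![0, -1; 1, 0])

open Matrix

section

variable {n : Type*} [Fintype n] [DecidableEq n]

theorem conj_det_one_add_I_smul (A : Matrix n n ℝ) :
    (starRingEnd ℂ) (1 + Complex.I • A.map Complex.ofReal).det =
      (1 - Complex.I • A.map Complex.ofReal).det := by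
  rw [RingHom.map_det]
  congr 1
  ext i j
  by_cases h : i = j <;> simp [h, sub_eq_add_neg]

/-- For real symmetric `A`, the matrix `1 + iA` is invertible because
`(1 + iA)(1 - iA) = 1 + AᵀA` is positive definite. -/
theorem det_one_add_I_smul_ne_zero {A : Matrix n n ℝ} (hA : A.IsSymm) :
    (1 + Complex.I • A.map Complex.ofReal).det ≠ 0 := by
  have hpos : 0 < (1 + Aᴴ * A).det :=
    (Matrix.PosDef.one.add_posSemidef (Matrix.posSemidef_conjTranspose_mul_self A)).det_pos
  have hfac : (1 + Complex.I • A.map Complex.ofReal) * (1 - Complex.I • A.map Complex.ofReal) =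
      (1 + Aᴴ * A).map Complex.ofReal := by
    have hmap : (1 + Aᴴ * A).map Complex.ofReal =
        1 + A.map Complex.ofReal * A.map Complex.ofReal := by
      rw [Matrix.conjTranspose_eq_transpose_of_trivial, hA.eq]
      change Complex.ofRealHom.mapMatrix (1 + A * A) = _
      rw [map_add, map_one, map_mul]
      rfl
    rw [hmap]
    simp only [add_mul, mul_sub, one_mul, mul_one, smul_mul_assoc, mul_smul_comm, smul_add,
      smul_smul, Complex.I_mul_I, neg_smul, one_smul]
    abel
  intro h0
  have hdet := congrArg Matrix.det hfac
  rw [Matrix.det_mul, h0, zero_mul] at hdet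
  have hcast : ((1 + Aᴴ * A).map Complex.ofReal).det = ((1 + Aᴴ * A).det : ℂ) :=
    (RingHom.map_det Complex.ofRealHom _).symm
  rw [hcast] at hdet
  exact hpos.ne (by exact_mod_cast hdet)

theorem det_one_add_I_smul_im_eq_zero {A J : Matrix n n ℝ} (hJ : J.det ≠ 0)
    (hAJ : A * J = -(J * A)) :
    (1 + Complex.I • A.map Complex.ofReal).det.im = 0 := by
  rw [← Complex.conj_eq_iff_im, conj_det_one_add_I_smul]
  have hJC : (J.map Complex.ofReal).det ≠ 0 := by
    have hcast : (J.map Complex.ofReal).det = (J.det : ℂ) :=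
      (RingHom.map_det Complex.ofRealHom _).symm
    rw [hcast]
    exact_mod_cast hJ
  have hC : A.map Complex.ofReal * J.map Complex.ofReal =
      -(J.map Complex.ofReal * A.map Complex.ofReal) := by
    have h := congrArg Complex.ofRealHom.mapMatrix hAJ
    rw [map_neg, map_mul, map_mul] at h
    exact h
  have hcomm : (1 - Complex.I • A.map Complex.ofReal) * J.map Complex.ofReal =
      J.map Complex.ofReal * (1 + Complex.I • A.map Complex.ofReal) := by
    rw [sub_mul, mul_add, smul_mul_assoc, hC, mul_smul_comm]
    simp
  have hdet := congrArg Matrix.det hcomm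
  rw [Matrix.det_mul, Matrix.det_mul, mul_comm] at hdet
  exact mul_left_cancel₀ hJC hdet

/-- The determinant is real and nonzero along the path `t ↦ 1 + itA`, and equals `1` at
`t = 0`, so it stays positive. -/
theorem det_one_add_I_smul_re_pos {A J : Matrix n n ℝ} (hA : A.IsSymm) (hJ : J.det ≠ 0)
    (hAJ : A * J = -(J * A)) :
    0 < (1 + Complex.I • A.map Complex.ofReal).det.re := by
  let f : ℝ → ℝ := fun t => (1 + Complex.I • (t • A).map Complex.ofReal).det.re
  have hf : Continuous f := by
    refine Complex.continuous_re.comp (Continuous.matrix_det ?_)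
    refine continuous_const.add (Continuous.const_smul ?_ Complex.I)
    exact (continuous_id.smul continuous_const).matrix_map Complex.continuous_ofReal
  have hf0 : f 0 = 1 := by simp [f]
  have hf1 : f 1 = (1 + Complex.I • A.map Complex.ofReal).det.re := by simp [f]
  have hne (t : ℝ) : f t ≠ 0 := fun h =>
    det_one_add_I_smul_ne_zero (hA.smul t) (Complex.ext h
      (det_one_add_I_smul_im_eq_zero hJ (by rw [smul_mul_assoc, hAJ, mul_smul_comm, smul_neg])))
  rw [← hf1]
  by_contra! hle
  obtain ⟨t, ht⟩ := mem_range_of_exists_le_of_exists_ge hf ⟨1, hle⟩ ⟨0, hf0 ▸ zero_le_one⟩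
  exact hne t ht

end

theorem det_Jblock (k : ℕ) : (Jblock k).det = 1 := by
  simp [Jblock, Matrix.det_blockDiagonal, Matrix.det_fin_two]

/-- Let `k > 0`, let `J_k` be the `2k × 2k` real block-diagonal matrix with `k` diagonal
blocks `[[0,-1],[1,0]]`, and let `A` be a real symmetric `2k × 2k` matrix with
`A * J_k = -(J_k * A)`. Regarding `A` as a complex matrix `A_ℂ` entrywise, the determinant
`det (1 + i • A_ℂ)` is a real number and is strictly positive: its imaginary part is `0`
and its real part is `> 0`. In particular `(det (1 + i • A_ℂ))²` is real and positive. -/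
theorem det_one_add_smul_I_pos (k : ℕ) (hk : 0 < k)
    (A : Matrix (Fin 2 × Fin k) (Fin 2 × Fin k) ℝ) (hA : A.IsSymm)
    (hAJ : A * Jblock k = -(Jblock k * A)) :
    ((1 + Complex.I • A.map (Complex.ofReal)).det).im = 0 ∧
    0 < ((1 + Complex.I • A.map (Complex.ofReal)).det).re ∧
    (((1 + Complex.I • A.map (Complex.ofReal)).det) ^ 2).im = 0 ∧
    0 < (((1 + Complex.I • A.map (Complex.ofReal)).det) ^ 2).re := by
  have hJ : (Jblock k).det ≠ 0 := by simp [det_Jblock]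
  have him := det_one_add_I_smul_im_eq_zero hJ hAJ
  have hre := det_one_add_I_smul_re_pos hA hJ hAJ
  refine ⟨him, hre, ?_, ?_⟩
  · simp [sq, him]
  · rw [sq, Complex.mul_re, him, mul_zero, sub_zero]
    exact mul_pos hre hre
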